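/- There exists an absolute constant η* > 0 such that the following holds whenever 0 < 1/n ≪ ε ≪ γ ≪ 1. Let H be a 3-graph on n vertices with δ₂(H) ≥ (1/2 − γ)n, and suppose there exists a vertex v ∈ V(H) such that there are fewer than εn³ edges e ∈ E(H) with v ∈ L(e). Then there exists V₀ ⊆ V(H) with |V₀| ≤ 8·ε^{1/4}·n such that H[V₀] contains a K₄⁻-factor and the 3-graph H ∖ V₀ (the subhypergraph induced on V(H)∖V₀) is (6, η*)-closed. -/

import Mathlib

open Finset

/-- `H` is the edge set of a 3-uniform hypergraph (3-graph) on `Fin n`. -/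
def Is3Graph (n : ℕ) (H : Finset (Finset (Fin n))) : Prop :=
  ∀ e ∈ H, e.card = 3

/-- `degOn H x y U` : number of `z ∈ U` with `{x,y,z} ∈ H`, i.e. `deg_H(xy, U)`. -/
def degOn {n : ℕ} (H : Finset (Finset (Fin n))) (x y : Fin n) (U : Finset (Fin n)) : ℕ :=
  (U.filter fun z => ({x, y, z} : Finset (Fin n)) ∈ H).card

/-- The minimum codegree `δ₂(H)` is at least `t`. -/
def CodegLB {n : ℕ} (H : Finset (Finset (Fin n))) (t : ℝ) : Prop :=
  ∀ x y : Fin n, x ≠ y → t ≤ (degOn H x y Finset.univ : ℝ)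

/-- `S` spans a copy of `K₄⁻` in `H`: it has 4 vertices and at least 3 of its
four 3-subsets are edges. -/
def SpansK4m {n : ℕ} (H : Finset (Finset (Fin n))) (S : Finset (Fin n)) : Prop :=
  S.card = 4 ∧ 3 ≤ ((S.powersetCard 3).filter (· ∈ H)).card

/-- `S` spans a copy of `K₄³` (the complete 3-graph on 4 vertices) in `H`. -/
def SpansK43 {n : ℕ} (H : Finset (Finset (Fin n))) (S : Finset (Fin n)) : Prop :=
  S.card = 4 ∧ ((S.powersetCard 3).filter (· ∈ H)).card = 4

/-- The induced subgraph `H[X]` contains a `K₄⁻`-factor. -/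
def HasK4mFactorOn {n : ℕ} (H : Finset (Finset (Fin n))) (X : Finset (Fin n)) : Prop :=
  ∃ P : Finset (Finset (Fin n)),
    (∀ S ∈ P, SpansK4m H S) ∧
    (∀ S ∈ P, ∀ T ∈ P, S ≠ T → Disjoint S T) ∧
    P.biUnion id = X

/-- `S` is an `(x,y)`-connector of length `c` in `H`. -/
def IsConnector {n : ℕ} (H : Finset (Finset (Fin n))) (c : ℕ) (x y : Fin n)
    (S : Finset (Fin n)) : Prop :=
  x ∉ S ∧ y ∉ S ∧ S.card = 4 * c - 1 ∧
    HasK4mFactorOn H (insert x S) ∧ HasK4mFactorOn H (insert y S)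

/-- `x` and `y` are `(c,η)`-close in `H` (a 3-graph on `n` vertices). -/
def Close {n : ℕ} (H : Finset (Finset (Fin n))) (c : ℕ) (η : ℝ) (x y : Fin n) : Prop :=
  η * (n : ℝ) ^ (4 * c - 1) ≤ ({S : Finset (Fin n) | IsConnector H c x y S}.ncard : ℝ)

/-- `U` is `(c,η)`-closed in `H`. -/
def ClosedOn {n : ℕ} (H : Finset (Finset (Fin n))) (c : ℕ) (η : ℝ)
    (U : Finset (Fin n)) : Prop :=
  ∀ x ∈ U, ∀ y ∈ U, x ≠ y → Close H c η x y

/-- The number of `(X,Y)`-bridges `(x,y,S)` of length `c` in `H`. -/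
noncomputable def BridgeCount {n : ℕ} (H : Finset (Finset (Fin n))) (c : ℕ)
    (X Y : Finset (Fin n)) : ℕ :=
  {t : Fin n × Fin n × Finset (Fin n) |
    t.1 ∈ X ∧ t.2.1 ∈ Y ∧ IsConnector H c t.1 t.2.1 t.2.2}.ncard

/-- The 3-graph `𝓑[A,B]`: all triples in `A ∪ B` containing an odd number of
vertices of `A`. -/
def BGraph {n : ℕ} (A B : Finset (Fin n)) : Finset (Finset (Fin n)) :=
  ((A ∪ B).powersetCard 3).filter fun e => (e ∩ A).card % 2 = 1

/-- `H` (a 3-graph on `n` vertices) is `γ`-extremal. -/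
def IsExtremal {n : ℕ} (H : Finset (Finset (Fin n))) (γ : ℝ) : Prop :=
  ∃ A B : Finset (Fin n), Disjoint A B ∧ A ∪ B = Finset.univ ∧
    A.card = n / 2 ∧ B.card = n - n / 2 ∧
    ((BGraph A B \ H).card : ℝ) ≤ γ * (n : ℝ) ^ 3

/-- The number of `V₁V₂V₃`-edges of `H`. -/
def eCount {n : ℕ} (H : Finset (Finset (Fin n))) (A B C : Finset (Fin n)) : ℕ :=
  (H.filter fun e => ∃ a ∈ A, ∃ b ∈ B, ∃ c ∈ C, e = {a, b, c}).card

/-- `Ñ_{c,η}(x)` : the set of vertices `(c,η)`-close to `x` in `H`. -/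
def Ntilde {n : ℕ} (H : Finset (Finset (Fin n))) (c : ℕ) (η : ℝ) (x : Fin n) :
    Set (Fin n) :=
  {y | y ≠ x ∧ Close H c η x y}

/-- The triple `{x,x',y}` is `(ρ,X,Y)`-typical. -/
def TypicalTriple {n : ℕ} (H : Finset (Finset (Fin n))) (ρ : ℝ) (X Y : Finset (Fin n))
    (x x' y : Fin n) : Prop :=
  (Y.card : ℝ) - ρ * n ≤ (degOn H x x' Y : ℝ) ∧
  (((X.filter fun z => ({x, y, z} : Finset (Fin n)) ∈ H ∧
      ({x', y, z} : Finset (Fin n)) ∈ H).card : ℝ) ≤ ρ * n) ∧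
  (X.card : ℝ) - ρ * n ≤ (degOn H x y X : ℝ) + (degOn H x' y X : ℝ)

/-- `Q` spans an `(X,Y)`-bridge of length 1, i.e. `Q = {a,b} ∪ S` for some
`(X,Y)`-bridge `(a,b,S)` of length 1. -/
def SpansBridge1 {n : ℕ} (H : Finset (Finset (Fin n))) (X Y Q : Finset (Fin n)) : Prop :=
  ∃ a ∈ X, ∃ b ∈ Y, ∃ S : Finset (Fin n), IsConnector H 1 a b S ∧
    Q = insert a (insert b S)

/-- `x` and `y` are `(c,η)`-close in the induced subgraph `H[W]`. -/
def CloseIn {n : ℕ} (H : Finset (Finset (Fin n))) (W : Finset (Fin n)) (c : ℕ) (η : ℝ)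
    (x y : Fin n) : Prop :=
  η * (W.card : ℝ) ^ (4 * c - 1) ≤
    ({S : Finset (Fin n) | S ⊆ W ∧ IsConnector H c x y S}.ncard : ℝ)

/-- The induced subgraph `H[W]` is `(c,η)`-closed. -/
def ClosedInSub {n : ℕ} (H : Finset (Finset (Fin n))) (W : Finset (Fin n)) (c : ℕ)
    (η : ℝ) : Prop :=
  ∀ x ∈ W, ∀ y ∈ W, x ≠ y → CloseIn H W c η x y

section Abstract

variable {V : Type*} [Fintype V] [DecidableEq V]

/-- Missing pairs inside one side of a partition. -/
lemma side_missing (χ : V → ℝ) (g : V → V → ℝ) (d : ℝ) (hd : 0 ≤ d)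
    (hχ : ∀ a, χ a = 0 ∨ χ a = 1) (hg : ∀ a b, g a b = 0 ∨ g a b = 1)
    (v : V) (hdeg : ∀ b, b ≠ v → d ≤ ∑ c, g b c) :
    ∑ b, ∑ c, χ b * χ c * (1 - g b c) ≤
      (∑ b, χ b) * ((∑ b, χ b) - d) + d + ∑ b, ∑ c, χ b * (1 - χ c) * g b c := by
  have h1 : ∑ b, ∑ c, χ b * χ c * (1 - g b c) =
      (∑ b, χ b) * (∑ c, χ c) - ∑ b, χ b * ∑ c, g b c
        + ∑ b, ∑ c, χ b * (1 - χ c) * g b c := by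
    rw [Finset.sum_mul_sum, ← Finset.sum_sub_distrib, ← Finset.sum_add_distrib]
    refine Finset.sum_congr rfl fun b _ => ?_
    rw [Finset.mul_sum, ← Finset.sum_sub_distrib, ← Finset.sum_add_distrib]
    refine Finset.sum_congr rfl fun c _ => ?_
    ring
  have h2 : ∑ b, (χ b * d - if b = v then d else 0) ≤ ∑ b, χ b * ∑ c, g b c := by
    refine Finset.sum_le_sum fun b _ => ?_
    have h0 : 0 ≤ ∑ c, g b c := Finset.sum_nonneg fun c _ => by
      rcases hg b c with h | h <;> rw [h] <;> norm_num
    by_cases hb : b = v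
    · rcases hχ b with h | h <;> rw [h] <;> simp [hb] <;> first | exact hd | skip
      rw [hb] at h0; linarith
    · have := hdeg b hb
      rcases hχ b with h | h <;> rw [h] <;> simp [hb]
      exact this
  rw [Finset.sum_sub_distrib, ← Finset.sum_mul] at h2
  simp at h2
  rw [h1]
  nlinarith

/-- Missing triples of type `AAB`. -/
lemma mixed_missing (χ : V → ℝ) (h : V → V → V → ℝ) (g : V → V → ℝ) (d : ℝ) (hd : 0 ≤ d)
    (hχ : ∀ a, χ a = 0 ∨ χ a = 1) (hg : ∀ a b, g a b = 0 ∨ g a b = 1)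
    (hh : ∀ a b c, h a b c = 0 ∨ h a b c = 1)
    (hdeg : ∀ a b, a ≠ b → d ≤ ∑ c, h a b c) :
    ∑ a, ∑ b, ∑ c, χ a * χ b * (1 - χ c) * (1 - h a b c) ≤
      (∑ a, χ a) * (∑ a, χ a) * ((Fintype.card V : ℝ) - (∑ a, χ a) - d)
        + Fintype.card V * d + ∑ a, ∑ b, ∑ c, h a b c * g a b * g a c
        + 2 * Fintype.card V * ∑ b, ∑ c, χ b * χ c * (1 - g b c) := by
  set N : ℝ := ((Fintype.card V : ℕ) : ℝ) with hN
  set s := ∑ a, χ a with hs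
  have e1 : ∑ a, ∑ b, ∑ c, χ a * χ b * (1 - χ c) * (1 - h a b c) =
      s * s * (N - s) - ∑ a, ∑ b, χ a * χ b * ∑ c, h a b c +
        ∑ a, ∑ b, ∑ c, χ a * χ b * χ c * h a b c := by
    have : s * s * (N - s) = ∑ a, ∑ b, ∑ c, χ a * χ b * (1 - χ c) := by
      simp_rw [← Finset.mul_sum, ← Finset.sum_mul]
      simp [Finset.sum_sub_distrib, ← Finset.mul_sum, ← Finset.sum_mul, hN, hs]
    rw [this, ← Finset.sum_sub_distrib, ← Finset.sum_add_distrib]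
    refine Finset.sum_congr rfl fun a _ => ?_
    rw [← Finset.sum_sub_distrib, ← Finset.sum_add_distrib]
    refine Finset.sum_congr rfl fun b _ => ?_
    rw [Finset.mul_sum, ← Finset.sum_sub_distrib, ← Finset.sum_add_distrib]
    refine Finset.sum_congr rfl fun c _ => ?_
    ring
  have e2 : ∑ a, ∑ b, (χ a * χ b * d - if a = b then d else 0) ≤
      ∑ a, ∑ b, χ a * χ b * ∑ c, h a b c := by
    refine Finset.sum_le_sum fun a _ => Finset.sum_le_sum fun b _ => ?_
    have h0 : 0 ≤ ∑ c, h a b c := Finset.sum_nonneg fun c _ => by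
      rcases hh a b c with h | h <;> rw [h] <;> norm_num
    by_cases hb : a = b
    · simp only [hb, if_true]
      rw [hb] at h0
      rcases hχ b with h | h <;> rw [h] <;> nlinarith
    · have := hdeg a b hb
      rcases hχ a with h | h <;> rcases hχ b with h' | h' <;> rw [h, h'] <;> simp [hb]
      exact this
  have e2' : ∑ a, ∑ b, (χ a * χ b * d - if a = b then d else 0) = s * s * d - N * d := by
    simp_rw [Finset.sum_sub_distrib, ← Finset.sum_mul, ← Finset.mul_sum, ← Finset.sum_mul]
    simp [hN, hs]
  have e3 : ∑ a, ∑ b, ∑ c, χ a * χ b * χ c * h a b c ≤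
      ∑ a, ∑ b, ∑ c, (h a b c * g a b * g a c + χ a * χ b * (1 - g a b)
        + χ a * χ c * (1 - g a c)) := by
    refine Finset.sum_le_sum fun a _ => Finset.sum_le_sum fun b _ =>
      Finset.sum_le_sum fun c _ => ?_
    rcases hχ a with h1 | h1 <;> rcases hχ b with h2 | h2 <;> rcases hχ c with h3 | h3 <;>
    rcases hg a b with h4 | h4 <;> rcases hg a c with h5 | h5 <;>
    rcases hh a b c with h6 | h6 <;> rw [h1, h2, h3, h4, h5, h6] <;> norm_num
  have e4 : ∑ a, ∑ b, ∑ c, (h a b c * g a b * g a c + χ a * χ b * (1 - g a b)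
        + χ a * χ c * (1 - g a c)) = ∑ a, ∑ b, ∑ c, h a b c * g a b * g a c
        + 2 * N * ∑ b, ∑ c, χ b * χ c * (1 - g b c) := by
    simp_rw [Finset.sum_add_distrib]
    simp only [Finset.sum_const, Finset.card_univ, nsmul_eq_mul, ← Finset.mul_sum, ← hN]
    ring
  rw [e1]
  rw [e2'] at e2
  rw [e4] at e3
  nlinarith

set_option maxHeartbeats 2000000 in
/-- Structure of `h` given one vertex in few good positions. -/
lemma structure_of_link (h : V → V → V → ℝ) (κ : ℝ) (hκ0 : 0 < κ) (hκ : κ ≤ 1 / 10 ^ 10)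
    (hN : 1 ≤ κ * (Fintype.card V : ℝ))
    (hh : ∀ a b c, h a b c = 0 ∨ h a b c = 1)
    (hs1 : ∀ a b c, h a b c = h b a c) (hs2 : ∀ a b c, h a b c = h a c b)
    (hdiag : ∀ a c, h a a c = 0)
    (hdeg : ∀ a b, a ≠ b → (1 / 2 - κ) * (Fintype.card V : ℝ) ≤ ∑ c, h a b c)
    (v : V)
    (hv : ∑ a, ∑ b, ∑ c, h a b c * h v a b * h v a c ≤ κ * (Fintype.card V : ℝ) ^ 3) :
    ∃ χ : V → ℝ, (∀ a, χ a = 0 ∨ χ a = 1) ∧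
      (1 / 2 - 100 * κ) * (Fintype.card V : ℝ) ≤ ∑ a, χ a ∧
      ∑ a, χ a ≤ (1 / 2 + 100 * κ) * (Fintype.card V : ℝ) ∧
      ∑ a, ∑ b, ∑ c, (1 - χ a * χ b * χ c - (1 - χ a) * (1 - χ b) * (1 - χ c)) *
        (1 - h a b c) ≤ 2200 * κ * (Fintype.card V : ℝ) ^ 3 := by
  set N : ℝ := ((Fintype.card V : ℕ) : ℝ) with hNdef
  have hN10 : (10 : ℝ) ^ 10 ≤ N := by
    have : 0 ≤ N := by positivity
    nlinarith
  have hh0 : ∀ a b c, 0 ≤ h a b c := fun a b c => by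
    rcases hh a b c with h | h <;> rw [h] <;> norm_num
  -- choose the base vertex
  obtain ⟨a₀, ha₀v, ha₀⟩ : ∃ a₀, a₀ ≠ v ∧
      ∑ b, ∑ c, (h a₀ b c * h v a₀ b * h v a₀ c + h a₀ b c * h v a₀ b * h v b c)
        ≤ 4 * κ * N ^ 2 := by
    by_contra hcon
    push Not at hcon
    have t1 : ∑ a, ∑ b, ∑ c, (h a b c * h v a b * h v a c + h a b c * h v a b * h v b c)
        ≤ 2 * κ * N ^ 3 := by
      simp_rw [Finset.sum_add_distrib]
      have : ∑ a, ∑ b, ∑ c, h a b c * h v a b * h v b c =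
          ∑ a, ∑ b, ∑ c, h a b c * h v a b * h v a c := by
        rw [Finset.sum_comm]
        refine Finset.sum_congr rfl fun a _ => Finset.sum_congr rfl fun b _ =>
          Finset.sum_congr rfl fun c _ => ?_
        rw [hs1 b a c, hs2 v b a]
      rw [this]; linarith
    have t2 : ∑ a, (4 * κ * N ^ 2 - if a = v then 4 * κ * N ^ 2 else 0) ≤
        ∑ a, ∑ b, ∑ c, (h a b c * h v a b * h v a c + h a b c * h v a b * h v b c) := by
      refine Finset.sum_le_sum fun a _ => ?_
      by_cases hav : a = v
      · simp only [hav, if_true, sub_self]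
        refine Finset.sum_nonneg fun b _ => Finset.sum_nonneg fun c _ => ?_
        have := hh0 v b c
        have := hh0 v v b
        have := hh0 v v c
        positivity
      · simp only [hav, if_false, sub_zero]
        exact (hcon a hav).le
    rw [Finset.sum_sub_distrib] at t2
    simp at t2
    rw [← hNdef] at t2
    have : 0 < κ * N ^ 2 := by positivity
    nlinarith
  set χ : V → ℝ := fun c => h v a₀ c with hχdef
  have hχ : ∀ a, χ a = 0 ∨ χ a = 1 := fun a => hh v a₀ a
  set s := ∑ a, χ a with hsdef
  have hs_lo : (1 / 2 - κ) * N ≤ s := hdeg v a₀ ha₀v.symm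
  have hs_hi : s ≤ N := by
    have : ∑ a, χ a ≤ ∑ a : V, (1 : ℝ) := Finset.sum_le_sum fun a _ => by
      rcases hχ a with h | h <;> rw [h] <;> norm_num
    simpa [hsdef, hNdef] using this
  set e := ∑ b, ∑ c, χ b * (1 - χ c) * h v b c with hedef
  have he0 : 0 ≤ e := Finset.sum_nonneg fun b _ => Finset.sum_nonneg fun c _ => by
    have := hh0 v b c
    rcases hχ b with h | h <;> rcases hχ c with h' | h' <;> rw [h, h'] <;> norm_num
    exact this
  have main : s * ((1 / 2 - κ) * N) + s * s + e ≤ s * N + 4 * κ * N ^ 2 := by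
    have p1 : ∑ b, ∑ c, (χ b * h a₀ b c + χ b * χ c + χ b * (1 - χ c) * h v b c) ≤
        ∑ b, ∑ c, (χ b * 1 +
          (h a₀ b c * h v a₀ b * h v a₀ c + h a₀ b c * h v a₀ b * h v b c)) := by
      refine Finset.sum_le_sum fun b _ => Finset.sum_le_sum fun c _ => ?_
      change χ b * h a₀ b c + χ b * χ c + χ b * (1 - χ c) * h v b c ≤
        χ b * 1 + (h a₀ b c * χ b * χ c + h a₀ b c * χ b * h v b c)
      rcases hχ b with h1 | h1 <;> rcases hχ c with h2 | h2 <;>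
      rcases hh a₀ b c with h3 | h3 <;> rcases hh v b c with h4 | h4 <;>
      rw [h1, h2, h3, h4] <;> norm_num
    simp_rw [Finset.sum_add_distrib] at p1 ha₀
    have p2 : s * ((1 / 2 - κ) * N) ≤ ∑ b, ∑ c, χ b * h a₀ b c := by
      rw [hsdef, Finset.sum_mul]
      refine Finset.sum_le_sum fun b _ => ?_
      rw [← Finset.mul_sum]
      by_cases hb : a₀ = b
      · have : χ b = 0 := by
          change h v a₀ b = 0
          rw [← hb, hs1, hs2, hdiag]
        rw [this]; simp
      · have := hdeg a₀ b hb
        rcases hχ b with h1 | h1 <;> rw [h1] <;> linarith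
    have p3 : ∑ b, ∑ c, χ b * χ c = s * s := by
      rw [hsdef, Finset.sum_mul_sum]
    have p4 : ∑ b, ∑ _c : V, χ b * 1 = s * N := by
      simp only [hsdef, hNdef, mul_one, Finset.sum_const, Finset.card_univ, nsmul_eq_mul]
      rw [← Finset.mul_sum, mul_comm]
    rw [p3, p4, ← hedef] at p1
    linarith
  have hs_up : s ≤ (1 / 2 + 100 * κ) * N := by
    by_contra hc
    push Not at hc
    have : 0 < s - (1/2 + 100*κ) * N := by linarith
    have : N/4 ≤ s := by nlinarith
    have : 0 < κ * N := by positivity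
    nlinarith
  have he_up : e ≤ 6 * κ * N ^ 2 := by
    have : s * ((1/2-κ)*N) ≤ s * s := by
      apply mul_le_mul_of_nonneg_left hs_lo
      nlinarith
    have : s * (κ * N) ≤ N * (κ * N) := mul_le_mul_of_nonneg_right hs_hi (by positivity)
    nlinarith
  -- the generic side estimate
  have side : ∀ ψ : V → ℝ, (∀ a, ψ a = 0 ∨ ψ a = 1) →
      (1 / 2 - 100 * κ) * N ≤ ∑ a, ψ a → ∑ a, ψ a ≤ (1 / 2 + 100 * κ) * N →
      ∑ b, ∑ c, ψ b * (1 - ψ c) * h v b c ≤ 6 * κ * N ^ 2 →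
      ∑ a, ∑ b, ∑ c, ψ a * ψ b * (1 - ψ c) * (1 - h a b c) ≤ 364 * κ * N ^ 3 := by
    intro ψ hψ hlo hhi he
    have hd : 0 ≤ (1 / 2 - κ) * N := by
      apply mul_nonneg <;> linarith
    have q1 := side_missing ψ (fun a b => h v a b) ((1 / 2 - κ) * N) hd hψ (fun a b => hh v a b) v
      (fun b hb => hdeg v b hb.symm)
    have q2 := mixed_missing ψ h (fun a b => h v a b) ((1 / 2 - κ) * N) hd hψ
      (fun a b => hh v a b) hh hdeg
    rw [← hNdef] at q2
    set S := ∑ a, ψ a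
    set m := ∑ b, ∑ c, ψ b * ψ c * (1 - h v b c)
    have hS0 : 0 ≤ S := le_trans (by apply mul_nonneg <;> linarith) hlo
    have hSN : S ≤ N := by nlinarith
    have hNN : N ≤ κ * N ^ 2 := by nlinarith
    have r1 : S * (S - (1 / 2 - κ) * N) ≤ N * (101 * κ * N) := by
      calc S * (S - (1 / 2 - κ) * N) ≤ S * (101 * κ * N) := by
            apply mul_le_mul_of_nonneg_left _ hS0; linarith
        _ ≤ N * (101 * κ * N) := mul_le_mul_of_nonneg_right hSN (by positivity)
    have hm : m ≤ 128 * κ * N ^ 2 := by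
      have : (1 / 2 - κ) * N ≤ N := by nlinarith
      nlinarith
    have r2 : S * S * (N - S - (1 / 2 - κ) * N) ≤ N * N * (101 * κ * N) := by
      calc S * S * (N - S - (1 / 2 - κ) * N) ≤ S * S * (101 * κ * N) := by
            apply mul_le_mul_of_nonneg_left _ (by positivity); linarith
        _ ≤ N * N * (101 * κ * N) := by
            apply mul_le_mul_of_nonneg_right _ (by positivity)
            exact mul_le_mul hSN hSN hS0 (by linarith)
    have r3 : N * ((1 / 2 - κ) * N) ≤ κ * N ^ 3 := by
      have : (1 / 2 - κ) * N ≤ N := by nlinarith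
      have := mul_le_mul_of_nonneg_left (this.trans hNN) (by linarith : 0 ≤ N)
      linarith
    have r4 : 2 * N * m ≤ 256 * κ * N ^ 3 := by
      have := mul_le_mul_of_nonneg_left hm (by linarith : 0 ≤ 2 * N)
      linarith
    have : 0 < κ * N ^ 3 := by positivity
    linarith
  have hκN : 0 < κ * N := by positivity
  have m1 := side χ hχ (by linarith) hs_up he_up
  have hψs : ∑ a, (1 - χ a) = N - s := by
    simp [Finset.sum_sub_distrib, hNdef, hsdef]
  have m2 := side (fun a => 1 - χ a) (fun a => by rcases hχ a with h | h <;> simp [h])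
    (by rw [hψs]; linarith) (by rw [hψs]; linarith) (by
      rw [Finset.sum_comm]
      refine le_trans (le_of_eq ?_) he_up
      rw [hedef]
      refine Finset.sum_congr rfl fun b _ => Finset.sum_congr rfl fun c _ => ?_
      rw [hs2 v c b]; ring)
  refine ⟨χ, hχ, by linarith, hs_up, ?_⟩
  set F : V → V → V → ℝ := fun a b c => χ a * χ b * (1 - χ c) * (1 - h a b c) +
    (1 - χ a) * (1 - χ b) * (1 - (1 - χ c)) * (1 - h a b c) with hF
  have f1 : ∑ a, ∑ b, ∑ c, F a b c ≤ 728 * κ * N ^ 3 := by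
    simp_rw [hF, Finset.sum_add_distrib]
    linarith
  have f2 : ∑ a, ∑ b, ∑ c, F a c b = ∑ a, ∑ b, ∑ c, F a b c :=
    Finset.sum_congr rfl fun a _ => Finset.sum_comm
  have f3 : ∑ a, ∑ b, ∑ c, F b c a = ∑ a, ∑ b, ∑ c, F a b c := by
    rw [← f2, Finset.sum_comm]
  have f4 : ∑ a, ∑ b, ∑ c, (1 - χ a * χ b * χ c - (1 - χ a) * (1 - χ b) * (1 - χ c)) *
        (1 - h a b c) ≤ ∑ a, ∑ b, ∑ c, (F a b c + F a c b + F b c a) := by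
    refine Finset.sum_le_sum fun a _ => Finset.sum_le_sum fun b _ =>
      Finset.sum_le_sum fun c _ => ?_
    have g1 : h a c b = h a b c := hs2 a c b
    have g2 : h b c a = h a b c := by rw [hs2 b c a, hs1 b a c]
    simp only [hF, g1, g2]
    have := hh a b c
    rcases hχ a with h1 | h1 <;> rcases hχ b with h2 | h2 <;> rcases hχ c with h3 | h3 <;>
    rcases hh a b c with h6 | h6 <;> rw [h1, h2, h3, h6] <;> norm_num
  simp_rw [Finset.sum_add_distrib] at f4
  rw [f2, f3] at f4
  have : 0 < κ * N ^ 3 := by positivity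
  linarith

end Abstract
section AbstractTwo

variable {V : Type*} [Fintype V] [DecidableEq V]

/-- Every vertex lies in many copies of `K₄⁻`. -/
lemma many_copies (χ : V → ℝ) (h : V → V → V → ℝ) (k : V → V → V → V → ℝ)
    (N : ℝ) (hNdef : N = (Fintype.card V : ℝ)) (hN : 10 ^ 10 ≤ N)
    (hχ : ∀ a, χ a = 0 ∨ χ a = 1)
    (hh : ∀ a b c, h a b c = 0 ∨ h a b c = 1)
    (hdiag : ∀ a c, h a a c = 0)
    (hdeg : ∀ a b, a ≠ b → 49 / 100 * N ≤ ∑ c, h a b c)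
    (hslo : 49 / 100 * N ≤ ∑ a, χ a) (hshi : ∑ a, χ a ≤ 51 / 100 * N)
    (hk1 : ∀ x a b c, h x a b * h x a c * h a b c ≤ k x a b c)
    (hk2 : ∀ x a b c, h x a b * h x a c * h x b c ≤ k x a b c)
    (hD : ∑ a, ∑ b, ∑ c, (1 - χ a * χ b * χ c - (1 - χ a) * (1 - χ b) * (1 - χ c)) *
        (1 - h a b c) ≤ 1 / 10 ^ 6 * N ^ 3) (x : V) :
    2 / 1000 * N ^ 3 ≤ ∑ a, ∑ b, ∑ c, k x a b c := by
  have hN3 : 0 < N ^ 3 := by positivity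
  set s := ∑ a, χ a with hs
  set e := ∑ b, ∑ c, χ b * (1 - χ c) * h x b c with he
  by_cases hcase : 1 / 100 * N ^ 2 ≤ e
  · have p1 : ∑ a, ∑ b, ∑ c, (χ a * (1 - χ b) * h x a b * h x a c -
        (1 - χ a * χ b * χ c - (1 - χ a) * (1 - χ b) * (1 - χ c)) * (1 - h a b c)) ≤
        ∑ a, ∑ b, ∑ c, k x a b c := by
      refine Finset.sum_le_sum fun a _ => Finset.sum_le_sum fun b _ =>
        Finset.sum_le_sum fun c _ => ?_
      refine le_trans ?_ (hk1 x a b c)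
      rcases hχ a with h1 | h1 <;> rcases hχ b with h2 | h2 <;> rcases hχ c with h3 | h3 <;>
      rcases hh x a b with h4 | h4 <;> rcases hh x a c with h5 | h5 <;>
      rcases hh a b c with h6 | h6 <;> rw [h1, h2, h3, h4, h5, h6] <;> norm_num
    simp_rw [Finset.sum_sub_distrib] at p1
    have p2 : e * (49 / 100 * N) ≤ ∑ a, ∑ b, ∑ c, χ a * (1 - χ b) * h x a b * h x a c := by
      rw [he, Finset.sum_mul]
      refine Finset.sum_le_sum fun a _ => ?_
      rw [Finset.sum_mul]
      refine Finset.sum_le_sum fun b _ => ?_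
      rw [← Finset.mul_sum]
      by_cases hax : x = a
      · rw [hax, hdiag]; simp
      · apply mul_le_mul_of_nonneg_left (hdeg x a hax)
        rcases hχ a with h1 | h1 <;> rcases hχ b with h2 | h2 <;>
        rcases hh x a b with h4 | h4 <;> rw [h1, h2, h4] <;> norm_num
    have p3 := mul_le_mul_of_nonneg_right hcase (by linarith : 0 ≤ 49 / 100 * N)
    linarith
  · push Not at hcase
    have q := side_missing χ (fun a b => h x a b) (49 / 100 * N) (by linarith) hχ
      (fun a b => hh x a b) x (fun b hb => hdeg x b hb.symm)
    rw [← hs, ← he] at q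
    set m := ∑ b, ∑ c, χ b * χ c * (1 - h x b c) with hm
    have hm' : m ≤ 21 / 1000 * N ^ 2 := by
      have : s * (s - 49 / 100 * N) ≤ (51 / 100 * N) * (2 / 100 * N) := by
        apply mul_le_mul <;> linarith
      nlinarith
    have p1 : ∑ a, ∑ b, ∑ c, (χ a * χ b * χ c - χ a * χ b * (1 - h x a b) -
        χ a * χ c * (1 - h x a c) - χ b * χ c * (1 - h x b c)) ≤
        ∑ a, ∑ b, ∑ c, k x a b c := by
      refine Finset.sum_le_sum fun a _ => Finset.sum_le_sum fun b _ =>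
        Finset.sum_le_sum fun c _ => ?_
      refine le_trans ?_ (hk2 x a b c)
      rcases hχ a with h1 | h1 <;> rcases hχ b with h2 | h2 <;> rcases hχ c with h3 | h3 <;>
      rcases hh x a b with h4 | h4 <;> rcases hh x a c with h5 | h5 <;>
      rcases hh x b c with h6 | h6 <;> rw [h1, h2, h3, h4, h5, h6] <;> norm_num
    have p2 : ∑ a, ∑ b, ∑ c, (χ a * χ b * χ c - χ a * χ b * (1 - h x a b) -
        χ a * χ c * (1 - h x a c) - χ b * χ c * (1 - h x b c)) = s * s * s - 3 * N * m := by
      simp_rw [Finset.sum_sub_distrib]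
      have : ∑ a, ∑ b, ∑ c, χ a * χ b * χ c = s * s * s := by
        simp_rw [← Finset.mul_sum, ← Finset.sum_mul, ← Finset.mul_sum, ← Finset.sum_mul]
        simp [hs]
      rw [this]
      simp only [Finset.sum_const, Finset.card_univ, nsmul_eq_mul, ← Finset.mul_sum, ← hNdef]
      rw [hm]; ring
    have p3 : (49 / 100 * N) * (49 / 100 * N) * (49 / 100 * N) ≤ s * s * s := by
      have h0 : 0 ≤ 49 / 100 * N := by linarith
      have h1 : 0 ≤ s := by linarith
      gcongr
    have p4 : N * m ≤ N * (21 / 1000 * N ^ 2) := mul_le_mul_of_nonneg_left hm' (by linarith)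
    linarith

set_option maxHeartbeats 4000000 in
/-- A pointwise inequality for 0/1 indicators. -/
lemma pointwise_k4 (t a b c p q r w K : ℝ) (ht : t = 0 ∨ t = 1) (ha : a = 0 ∨ a = 1)
    (hb : b = 0 ∨ b = 1) (hc : c = 0 ∨ c = 1) (hp : p = 0 ∨ p = 1) (hq : q = 0 ∨ q = 1)
    (hr : r = 0 ∨ r = 1) (hw : w = 0 ∨ w = 1) (k0 : 0 ≤ K) (k1 : p * q * w ≤ K)
    (k2 : p * q * r ≤ K) (k3 : p * r * w ≤ K) (k4 : q * r * w ≤ K) :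
    (1 - t * a * b * c - (1 - t) * (1 - a) * (1 - b) * (1 - c)) * (1 - K) ≤
      (1 - t * a * b - (1 - t) * (1 - a) * (1 - b)) * (1 - p) +
      (1 - t * a * c - (1 - t) * (1 - a) * (1 - c)) * (1 - q) +
      (1 - t * b * c - (1 - t) * (1 - b) * (1 - c)) * (1 - r) +
      (1 - a * b * c - (1 - a) * (1 - b) * (1 - c)) * (1 - w) := by
  rcases ht with rfl | rfl <;> rcases ha with rfl | rfl <;> rcases hb with rfl | rfl <;>
  rcases hc with rfl | rfl <;> rcases hp with rfl | rfl <;> rcases hq with rfl | rfl <;>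
  rcases hr with rfl | rfl <;> rcases hw with rfl | rfl <;> linarith

set_option maxHeartbeats 2000000 in
/-- The abstract closeness statement. -/
lemma abstract_close (χ : V → ℝ) (h : V → V → V → ℝ) (k : V → V → V → V → ℝ)
    (N : ℝ) (hNdef : N = (Fintype.card V : ℝ)) (hN : 10 ^ 10 ≤ N)
    (hχ : ∀ a, χ a = 0 ∨ χ a = 1)
    (hh : ∀ a b c, h a b c = 0 ∨ h a b c = 1)
    (hk : ∀ x a b c, k x a b c = 0 ∨ k x a b c = 1)
    (hdiag : ∀ a c, h a a c = 0)
    (hdeg : ∀ a b, a ≠ b → 49 / 100 * N ≤ ∑ c, h a b c)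
    (hslo : 49 / 100 * N ≤ ∑ a, χ a) (hshi : ∑ a, χ a ≤ 51 / 100 * N)
    (hk1 : ∀ x a b c, h x a b * h x a c * h a b c ≤ k x a b c)
    (hk2 : ∀ x a b c, h x a b * h x a c * h x b c ≤ k x a b c)
    (hk3 : ∀ x a b c, h x a b * h x b c * h a b c ≤ k x a b c)
    (hk4 : ∀ x a b c, h x a c * h x b c * h a b c ≤ k x a b c)
    (hD : ∑ a, ∑ b, ∑ c, (1 - χ a * χ b * χ c - (1 - χ a) * (1 - χ b) * (1 - χ c)) *
        (1 - h a b c) ≤ 1 / 10 ^ 6 * N ^ 3) :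
    ∃ T : Finset V,
      (∀ t ∈ T, ∀ t' ∈ T, 1 / 10 ^ 4 * N ^ 3 ≤ ∑ a, ∑ b, ∑ c, k t a b c * k t' a b c) ∧
      ∀ x, 1 / 10 ^ 4 * N ≤
        ((T.filter fun t => 1 / 10 ^ 4 * N ^ 3 ≤ ∑ a, ∑ b, ∑ c, k x a b c * k t a b c).card : ℝ) := by
  have hN0 : 0 < N := by linarith
  have hN3 : 0 < N ^ 3 := by positivity
  have hN4 : 0 < N ^ 4 := by positivity
  have hk0 : ∀ x a b c, 0 ≤ k x a b c := fun x a b c => by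
    rcases hk x a b c with h | h <;> rw [h] <;> norm_num
  have hk1' : ∀ x a b c, k x a b c ≤ 1 := fun x a b c => by
    rcases hk x a b c with h | h <;> rw [h] <;> norm_num
  set s := ∑ a, χ a with hs
  set Q : V → V → V → ℝ := fun a b c =>
    (1 - χ a * χ b * χ c - (1 - χ a) * (1 - χ b) * (1 - χ c)) * (1 - h a b c) with hQ
  set R : V → V → V → V → ℝ := fun t a b c =>
    (1 - χ t * χ a * χ b * χ c - (1 - χ t) * (1 - χ a) * (1 - χ b) * (1 - χ c)) with hR
  have hR01 : ∀ t a b c, R t a b c = 0 ∨ R t a b c = 1 := by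
    intro t a b c
    simp only [hR]
    rcases hχ t with h0 | h0 <;> rcases hχ a with h1 | h1 <;> rcases hχ b with h2 | h2 <;>
      rcases hχ c with h3 | h3 <;> rw [h0, h1, h2, h3] <;> norm_num
  have hRk : ∑ t, ∑ a, ∑ b, ∑ c, R t a b c * (1 - k t a b c) ≤ 4 / 10 ^ 6 * N ^ 4 := by
    have p1 : ∑ t, ∑ a, ∑ b, ∑ c, R t a b c * (1 - k t a b c) ≤
        ∑ t, ∑ a, ∑ b, ∑ c, (Q t a b + Q t a c + Q t b c + Q a b c) := by
      refine Finset.sum_le_sum fun t _ => Finset.sum_le_sum fun a _ =>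
        Finset.sum_le_sum fun b _ => Finset.sum_le_sum fun c _ => ?_
      have k1 := hk1 t a b c
      have k2 := hk2 t a b c
      have k3 := hk3 t a b c
      have k4 := hk4 t a b c
      have k0 := hk0 t a b c
      exact pointwise_k4 _ _ _ _ _ _ _ _ _ (hχ t) (hχ a) (hχ b) (hχ c) (hh t a b) (hh t a c)
        (hh t b c) (hh a b c) k0 k1 k2 k3 k4
    have p2 : ∑ t, ∑ a, ∑ b, ∑ c, (Q t a b + Q t a c + Q t b c + Q a b c) =
        4 * N * ∑ a, ∑ b, ∑ c, Q a b c := by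
      simp_rw [Finset.sum_add_distrib]
      simp only [Finset.sum_const, Finset.card_univ, nsmul_eq_mul, ← Finset.mul_sum, ← hNdef]
      ring
    rw [p2] at p1
    have := mul_le_mul_of_nonneg_left hD (by linarith : 0 ≤ 4 * N)
    linarith
  set W : V → ℝ := fun t => ∑ a, ∑ b, ∑ c, χ a * (1 - χ b) * (1 - k t a b c) with hW
  have hW0 : ∀ t, 0 ≤ W t := fun t => Finset.sum_nonneg fun a _ => Finset.sum_nonneg fun b _ =>
    Finset.sum_nonneg fun c _ => by
      have := hk1' t a b c
      rcases hχ a with h1 | h1 <;> rcases hχ b with h2 | h2 <;> rw [h1, h2] <;> norm_num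
      linarith
  have hWsum : ∑ t, W t ≤ 4 / 10 ^ 6 * N ^ 4 := by
    refine le_trans ?_ hRk
    refine Finset.sum_le_sum fun t _ => Finset.sum_le_sum fun a _ =>
        Finset.sum_le_sum fun b _ => Finset.sum_le_sum fun c _ => ?_
    refine mul_le_mul_of_nonneg_right ?_ (by linarith [hk1' t a b c])
    simp only [hR]
    rcases hχ t with h0 | h0 <;> rcases hχ a with h1 | h1 <;> rcases hχ b with h2 | h2 <;>
      rcases hχ c with h3 | h3 <;> rw [h0, h1, h2, h3] <;> norm_num
  set J : V → V → ℝ := fun x t => ∑ a, ∑ b, ∑ c, k x a b c * k t a b c with hJ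
  have hJ1 : ∀ x t, J x t ≤ N ^ 3 := by
    intro x t
    have : J x t ≤ ∑ _a : V, ∑ _b : V, ∑ _c : V, (1 : ℝ) :=
      Finset.sum_le_sum fun a _ => Finset.sum_le_sum fun b _ => Finset.sum_le_sum fun c _ => by
        rcases hk x a b c with h1 | h1 <;> rcases hk t a b c with h2 | h2 <;> rw [h1, h2] <;>
          norm_num
    simp only [Finset.sum_const, Finset.card_univ, nsmul_eq_mul, ← hNdef] at this
    linarith
  set T : Finset V := Finset.univ.filter fun t => W t ≤ 5 / 100 * N ^ 3 with hT
  refine ⟨T, ?_, ?_⟩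
  · intro t ht t' ht'
    rw [hT, Finset.mem_filter] at ht ht'
    have p1 : ∑ a, ∑ b, ∑ c, (χ a * (1 - χ b) - χ a * (1 - χ b) * (1 - k t a b c) -
        χ a * (1 - χ b) * (1 - k t' a b c)) ≤ ∑ a, ∑ b, ∑ c, k t a b c * k t' a b c := by
      refine Finset.sum_le_sum fun a _ => Finset.sum_le_sum fun b _ =>
        Finset.sum_le_sum fun c _ => ?_
      rcases hχ a with h1 | h1 <;> rcases hχ b with h2 | h2 <;>
      rcases hk t a b c with h3 | h3 <;> rcases hk t' a b c with h4 | h4 <;>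
      rw [h1, h2, h3, h4] <;> norm_num
    simp_rw [Finset.sum_sub_distrib] at p1
    have p2 : ∑ a, ∑ b, ∑ _c : V, χ a * (1 - χ b) = s * (N - s) * N := by
      simp only [Finset.sum_const, Finset.card_univ, nsmul_eq_mul, ← hNdef]
      simp_rw [← Finset.mul_sum, ← Finset.sum_mul]
      rw [Finset.sum_sub_distrib, ← hs]
      simp only [Finset.sum_const, Finset.card_univ, nsmul_eq_mul, ← hNdef]
      ring
    have p3 : (49 / 100 * N) * (49 / 100 * N) * N ≤ s * (N - s) * N := by
      have h0 : 0 ≤ 49 / 100 * N := by linarith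
      have h1 : 0 ≤ s := by linarith
      have h2 : 49 / 100 * N ≤ N - s := by linarith
      gcongr
    rw [p2] at p1
    have h1 := ht.2
    have h2 := ht'.2
    simp only [hW] at h1 h2
    linarith
  · intro x
    have hK := many_copies χ h k N hNdef hN hχ hh hdiag hdeg hslo hshi hk1 hk2 hD x
    have p1 : ∑ t, ∑ a, ∑ b, ∑ c, (k x a b c * R t a b c - R t a b c * (1 - k t a b c)) ≤
        ∑ t, J x t := by
      refine Finset.sum_le_sum fun t _ => Finset.sum_le_sum fun a _ =>
        Finset.sum_le_sum fun b _ => Finset.sum_le_sum fun c _ => ?_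
      rcases hR01 t a b c with h1 | h1 <;>
      rcases hk t a b c with h3 | h3 <;> rcases hk x a b c with h4 | h4 <;>
      rw [h1, h3, h4] <;> norm_num
    simp_rw [Finset.sum_sub_distrib] at p1
    have p2 : (49 / 100 * N) * ∑ a, ∑ b, ∑ c, k x a b c ≤
        ∑ t, ∑ a, ∑ b, ∑ c, k x a b c * R t a b c := by
      rw [Finset.mul_sum]
      refine le_of_le_of_eq ?_ Finset.sum_comm
      refine Finset.sum_le_sum fun a _ => ?_
      rw [Finset.mul_sum]
      refine le_of_le_of_eq ?_ Finset.sum_comm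
      refine Finset.sum_le_sum fun b _ => ?_
      rw [Finset.mul_sum]
      refine le_of_le_of_eq ?_ Finset.sum_comm
      refine Finset.sum_le_sum fun c _ => ?_
      rw [← Finset.mul_sum, mul_comm]
      refine mul_le_mul_of_nonneg_left ?_ (hk0 x a b c)
      simp only [hR]
      rcases hχ a with h1 | h1 <;> rcases hχ b with h2 | h2 <;>
      rcases hχ c with h3 | h3 <;> rw [h1, h2, h3] <;>
        simp [Finset.sum_sub_distrib, ← hNdef, ← hs] <;> linarith
    have p3 := mul_le_mul_of_nonneg_left hK (by linarith : 0 ≤ 49 / 100 * N)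
    have pT : ∑ t, J x t ≤ ∑ t, (1 / 10 ^ 4 * N ^ 3 +
        (if t ∈ T.filter (fun t => 1 / 10 ^ 4 * N ^ 3 ≤ J x t) then N ^ 3 else 0) +
        20 * W t) := by
      refine Finset.sum_le_sum fun t _ => ?_
      have w0 := hW0 t
      by_cases htT : t ∈ T
      · by_cases htJ : 1 / 10 ^ 4 * N ^ 3 ≤ J x t
        · rw [if_pos (Finset.mem_filter.2 ⟨htT, htJ⟩)]
          linarith [hJ1 x t]
        · have hm : t ∉ T.filter (fun t => 1 / 10 ^ 4 * N ^ 3 ≤ J x t) :=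
            fun hm => htJ (Finset.mem_filter.1 hm).2
          rw [if_neg hm]
          push Not at htJ
          linarith
      · have hm : t ∉ T.filter (fun t => 1 / 10 ^ 4 * N ^ 3 ≤ J x t) :=
          fun hm => htT (Finset.mem_filter.1 hm).1
        rw [if_neg hm]
        have : 5 / 100 * N ^ 3 < W t := by
          by_contra hc
          exact htT (by rw [hT, Finset.mem_filter]; exact ⟨Finset.mem_univ _, not_lt.1 hc⟩)
        linarith [hJ1 x t]
    simp_rw [Finset.sum_add_distrib] at pT
    have p20 : ∑ t, 20 * W t = 20 * ∑ t, W t := by rw [Finset.mul_sum]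
    rw [p20, Finset.sum_ite_mem, Finset.univ_inter] at pT
    simp only [Finset.sum_const, Finset.card_univ, nsmul_eq_mul, ← hNdef] at pT
    have fin : 1 / 10 ^ 4 * N * N ^ 3 ≤
      ((T.filter fun t => 1 / 10 ^ 4 * N ^ 3 ≤ J x t).card : ℝ) * N ^ 3 := by
      linarith
    exact le_of_mul_le_mul_right fin hN3

end AbstractTwo
section Concrete

/-- Ordered triples versus sets. -/
lemma ordered_le {n : ℕ} (p : Fin n → Fin n → Fin n → ℝ) (F : Finset (Finset (Fin n)))
    (hF : ∀ S ∈ F, S.card = 3) (hp0 : ∀ a b c, p a b c ≤ 1)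
    (hp : ∀ a b c, 0 < p a b c → ({a, b, c} : Finset (Fin n)) ∈ F) :
    ∑ a, ∑ b, ∑ c, p a b c ≤ 27 * (F.card : ℝ) := by
  classical
  set A : Finset (Fin n × Fin n × Fin n) :=
    Finset.univ.filter fun t => ({t.1, t.2.1, t.2.2} : Finset (Fin n)) ∈ F with hA
  have h1 : A.card ≤ 27 * F.card := by
    refine Finset.card_le_mul_card_image_of_maps_to
      (f := fun t : Fin n × Fin n × Fin n => ({t.1, t.2.1, t.2.2} : Finset (Fin n))) ?_ 27 ?_
    · intro t ht
      exact (Finset.mem_filter.1 ht).2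
    · intro S hS
      have : (A.filter fun t => ({t.1, t.2.1, t.2.2} : Finset (Fin n)) = S) ⊆ S ×ˢ S ×ˢ S := by
        intro t ht
        have := (Finset.mem_filter.1 ht).2
        rw [← this]
        simp
      refine (Finset.card_le_card this).trans ?_
      rw [Finset.card_product, Finset.card_product, hF S hS]
  have h2 : ∑ a, ∑ b, ∑ c, p a b c ≤ (A.card : ℝ) := by
    rw [hA, Finset.card_filter]
    push_cast
    rw [Fintype.sum_prod_type]
    refine Finset.sum_le_sum fun a _ => ?_
    rw [Fintype.sum_prod_type]
    refine Finset.sum_le_sum fun b _ => Finset.sum_le_sum fun c _ => ?_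
    by_cases h : 0 < p a b c
    · rw [if_pos (hp a b c h)]; exact hp0 a b c
    · push Not at h
      refine h.trans ?_
      split_ifs <;> norm_num
  refine h2.trans ?_
  exact_mod_cast h1

lemma ne_of_card_three {n : ℕ} {a b c : Fin n} (h : ({a, b, c} : Finset (Fin n)).card = 3) :
    a ≠ b ∧ a ≠ c ∧ b ≠ c := by
  refine ⟨?_, ?_, ?_⟩
  · rintro rfl
    have := Finset.card_le_two (a := a) (b := c)
    simp at h
    omega
  · rintro rfl
    have := Finset.card_le_two (a := b) (b := a)
    rw [Finset.insert_comm] at h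
    simp at h
    omega
  · rintro rfl
    have := Finset.card_le_two (a := a) (b := b)
    simp at h
    omega

lemma spans_of_three {n : ℕ} {H : Finset (Finset (Fin n))} {S e₁ e₂ e₃ : Finset (Fin n)}
    (h3 : Is3Graph n H) (hS : S.card = 4) (h1 : e₁ ∈ H) (h2 : e₂ ∈ H) (h3' : e₃ ∈ H)
    (s1 : e₁ ⊆ S) (s2 : e₂ ⊆ S) (s3 : e₃ ⊆ S) (n12 : e₁ ≠ e₂) (n13 : e₁ ≠ e₃) (n23 : e₂ ≠ e₃) :
    SpansK4m H S := by
  refine ⟨hS, ?_⟩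
  have : ({e₁, e₂, e₃} : Finset (Finset (Fin n))) ⊆ (S.powersetCard 3).filter (· ∈ H) := by
    intro e he
    simp only [Finset.mem_insert, Finset.mem_singleton] at he
    rw [Finset.mem_filter, Finset.mem_powersetCard]
    rcases he with rfl | rfl | rfl
    · exact ⟨⟨s1, h3 _ h1⟩, h1⟩
    · exact ⟨⟨s2, h3 _ h2⟩, h2⟩
    · exact ⟨⟨s3, h3 _ h3'⟩, h3'⟩
  refine le_trans (le_of_eq ?_) (Finset.card_le_card this)
  rw [Finset.card_eq_three.2 ⟨e₁, e₂, e₃, n12, n13, n23, rfl⟩]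

lemma triples_ne {n : ℕ} {x a b c : Fin n} (h1 : x ≠ a) (h2 : x ≠ b) (h3 : x ≠ c)
    (h4 : a ≠ b) (h5 : a ≠ c) (h6 : b ≠ c) :
    ({x, a, b, c} : Finset (Fin n)).card = 4 ∧
    ({x, a, b} : Finset (Fin n)) ≠ {x, a, c} ∧ ({x, a, b} : Finset (Fin n)) ≠ {x, b, c} ∧
    ({x, a, b} : Finset (Fin n)) ≠ {a, b, c} ∧ ({x, a, c} : Finset (Fin n)) ≠ {x, b, c} ∧
    ({x, a, c} : Finset (Fin n)) ≠ {a, b, c} ∧ ({x, b, c} : Finset (Fin n)) ≠ {a, b, c} := by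
  refine ⟨?_, ?_, ?_, ?_, ?_, ?_, ?_⟩
  · rw [Finset.card_insert_of_notMem, Finset.card_insert_of_notMem,
      Finset.card_insert_of_notMem, Finset.card_singleton] <;> simp [*]
  · intro h; have : c ∈ ({x, a, b} : Finset (Fin n)) := by rw [h]; simp
    simp [h3.symm, h5.symm, h6.symm] at this
  · intro h; have : c ∈ ({x, a, b} : Finset (Fin n)) := by rw [h]; simp
    simp [h3.symm, h5.symm, h6.symm] at this
  · intro h; have : c ∈ ({x, a, b} : Finset (Fin n)) := by rw [h]; simp
    simp [h3.symm, h5.symm, h6.symm] at this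
  · intro h; have : b ∈ ({x, a, c} : Finset (Fin n)) := by rw [h]; simp
    simp [h2.symm, h4.symm, h6] at this
  · intro h; have : b ∈ ({x, a, c} : Finset (Fin n)) := by rw [h]; simp
    simp [h2.symm, h4.symm, h6] at this
  · intro h; have : a ∈ ({x, b, c} : Finset (Fin n)) := by rw [h]; simp
    simp [h1.symm, h4, h5] at this

lemma ite_three_le (P Q R S : Prop) [Decidable P] [Decidable Q] [Decidable R] [Decidable S]
    (h : P → Q → R → S) :
    (if P then (1 : ℝ) else 0) * (if Q then 1 else 0) * (if R then 1 else 0) ≤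
      if S then 1 else 0 := by
  by_cases hP : P <;> by_cases hQ : Q <;> by_cases hR : R
  · simp [hP, hQ, hR, h hP hQ hR]
  all_goals simp [hP, hQ, hR]; try (split_ifs <;> norm_num)

/-- Indicator of being an edge. -/
noncomputable def hInd {n : ℕ} (H : Finset (Finset (Fin n))) (a b c : Fin n) : ℝ :=
  if ({a, b, c} : Finset (Fin n)) ∈ H then 1 else 0

open Classical in
/-- Indicator of spanning `K₄⁻`. -/
noncomputable def kInd {n : ℕ} (H : Finset (Finset (Fin n))) (x a b c : Fin n) : ℝ :=
  if SpansK4m H ({x, a, b, c} : Finset (Fin n)) then 1 else 0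

lemma kInd_bounds {n : ℕ} (H : Finset (Finset (Fin n))) (h3 : Is3Graph n H) (x a b c : Fin n) :
    hInd H x a b * hInd H x a c * hInd H a b c ≤ kInd H x a b c ∧
    hInd H x a b * hInd H x a c * hInd H x b c ≤ kInd H x a b c ∧
    hInd H x a b * hInd H x b c * hInd H a b c ≤ kInd H x a b c ∧
    hInd H x a c * hInd H x b c * hInd H a b c ≤ kInd H x a b c := by
  classical
  have s1 : ({x, a, b} : Finset (Fin n)) ⊆ {x, a, b, c} := by
    intro y; simp only [Finset.mem_insert, Finset.mem_singleton]; tauto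
  have s2 : ({x, a, c} : Finset (Fin n)) ⊆ {x, a, b, c} := by
    intro y; simp only [Finset.mem_insert, Finset.mem_singleton]; tauto
  have s3 : ({x, b, c} : Finset (Fin n)) ⊆ {x, a, b, c} := by
    intro y; simp only [Finset.mem_insert, Finset.mem_singleton]; tauto
  have s4 : ({a, b, c} : Finset (Fin n)) ⊆ {x, a, b, c} := by
    intro y; simp only [Finset.mem_insert, Finset.mem_singleton]; tauto
  unfold hInd kInd
  refine ⟨?_, ?_, ?_, ?_⟩ <;> refine ite_three_le _ _ _ _ fun e1 e2 e3 => ?_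
  · obtain ⟨xa, xb, ab⟩ := ne_of_card_three (h3 _ e1)
    obtain ⟨-, xc, ac⟩ := ne_of_card_three (h3 _ e2)
    obtain ⟨-, -, bc⟩ := ne_of_card_three (h3 _ e3)
    obtain ⟨hc, t1, t2, t3, t4, t5, t6⟩ := triples_ne xa xb xc ab ac bc
    exact spans_of_three h3 hc e1 e2 e3 s1 s2 s4 t1 t3 t5
  · obtain ⟨xa, xb, ab⟩ := ne_of_card_three (h3 _ e1)
    obtain ⟨-, xc, ac⟩ := ne_of_card_three (h3 _ e2)
    obtain ⟨-, -, bc⟩ := ne_of_card_three (h3 _ e3)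
    obtain ⟨hc, t1, t2, t3, t4, t5, t6⟩ := triples_ne xa xb xc ab ac bc
    exact spans_of_three h3 hc e1 e2 e3 s1 s2 s3 t1 t2 t4
  · obtain ⟨xa, xb, ab⟩ := ne_of_card_three (h3 _ e1)
    obtain ⟨-, xc, bc⟩ := ne_of_card_three (h3 _ e2)
    obtain ⟨-, ac, -⟩ := ne_of_card_three (h3 _ e3)
    obtain ⟨hc, t1, t2, t3, t4, t5, t6⟩ := triples_ne xa xb xc ab ac bc
    exact spans_of_three h3 hc e1 e2 e3 s1 s3 s4 t2 t3 t6
  · obtain ⟨xa, xc, ac⟩ := ne_of_card_three (h3 _ e1)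
    obtain ⟨xb, -, bc⟩ := ne_of_card_three (h3 _ e2)
    obtain ⟨ab, -, -⟩ := ne_of_card_three (h3 _ e3)
    obtain ⟨hc, t1, t2, t3, t4, t5, t6⟩ := triples_ne xa xb xc ab ac bc
    exact spans_of_three h3 hc e1 e2 e3 s2 s3 s4 t4 t5 t6

lemma factor_single {n : ℕ} {H : Finset (Finset (Fin n))} {S : Finset (Fin n)}
    (h : SpansK4m H S) : HasK4mFactorOn H S := by
  refine ⟨{S}, ?_, ?_, ?_⟩
  · intro T hT; rw [Finset.mem_singleton.1 hT]; exact h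
  · intro T hT U hU hne
    rw [Finset.mem_singleton.1 hT, Finset.mem_singleton.1 hU] at hne
    exact absurd rfl hne
  · simp

lemma factor_union {n : ℕ} {H : Finset (Finset (Fin n))} {X Y : Finset (Fin n)}
    (hX : HasK4mFactorOn H X) (hY : HasK4mFactorOn H Y) (hd : Disjoint X Y) :
    HasK4mFactorOn H (X ∪ Y) := by
  obtain ⟨P, hP1, hP2, hP3⟩ := hX
  obtain ⟨Q, hQ1, hQ2, hQ3⟩ := hY
  have hPs : ∀ S ∈ P, S ⊆ X := fun S hS => hP3 ▸ Finset.subset_biUnion_of_mem id hS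
  have hQs : ∀ S ∈ Q, S ⊆ Y := fun S hS => hQ3 ▸ Finset.subset_biUnion_of_mem id hS
  refine ⟨P ∪ Q, ?_, ?_, ?_⟩
  · intro S hS
    rcases Finset.mem_union.1 hS with h | h
    · exact hP1 S h
    · exact hQ1 S h
  · intro S hS T hT hne
    rcases Finset.mem_union.1 hS with h | h <;> rcases Finset.mem_union.1 hT with h' | h'
    · exact hP2 S h T h' hne
    · exact Finset.disjoint_of_subset_left (hPs S h) (Finset.disjoint_of_subset_right (hQs T h') hd)
    · exact (Finset.disjoint_of_subset_left (hPs T h')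
        (Finset.disjoint_of_subset_right (hQs S h) hd)).symm
    · exact hQ2 S h T h' hne
  · rw [Finset.union_biUnion, hP3, hQ3]

lemma close_symm {n : ℕ} {H : Finset (Finset (Fin n))} {c : ℕ} {η : ℝ} {x y : Fin n}
    (h : Close H c η x y) : Close H c η y x := by
  unfold Close at *
  have : {S : Finset (Fin n) | IsConnector H c y x S} = {S | IsConnector H c x y S} := by
    ext S
    simp only [Set.mem_ofPred_eq, IsConnector]
    tauto
  rw [this]; exact h

lemma close_one {n : ℕ} {H : Finset (Finset (Fin n))} {β : ℝ} {x y : Fin n}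
    (h : β * (n : ℝ) ^ 3 ≤ ∑ a, ∑ b, ∑ c, kInd H x a b c * kInd H y a b c) :
    Close H 1 (β / 27) x y := by
  classical
  unfold Close
  set F : Finset (Finset (Fin n)) := Finset.univ.filter fun S => IsConnector H 1 x y S with hF
  have e : {S : Finset (Fin n) | IsConnector H 1 x y S} = (F : Set (Finset (Fin n))) := by
    ext S; simp [hF]
  rw [e, Set.ncard_coe_finset]
  have := ordered_le (fun a b c => kInd H x a b c * kInd H y a b c) F
    (fun S hS => (Finset.mem_filter.1 hS).2.2.2.1)
    (fun a b c => by unfold kInd; split_ifs <;> norm_num)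
    (fun a b c habc => by
      unfold kInd at habc
      split_ifs at habc with h1 h2 <;> norm_num at habc
      rw [hF, Finset.mem_filter]
      have hx : x ∉ ({a, b, c} : Finset (Fin n)) := by
        intro hx
        have c4 := h1.1
        rw [Finset.insert_eq_of_mem hx] at c4
        have := Finset.card_le_three (a := a) (b := b) (c := c)
        omega
      have hy : y ∉ ({a, b, c} : Finset (Fin n)) := by
        intro hx
        have c4 := h2.1
        rw [Finset.insert_eq_of_mem hx] at c4
        have := Finset.card_le_three (a := a) (b := b) (c := c)
        omega
      refine ⟨Finset.mem_univ _, hx, hy, ?_, factor_single h1, factor_single h2⟩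
      have c4 := h1.1
      rw [Finset.card_insert_of_notMem hx] at c4
      omega)
  norm_num
  linarith

lemma count_hit {n : ℕ} (m : ℕ) (hm : 1 ≤ m) (X : Finset (Fin n)) :
    ((Finset.univ : Finset (Finset (Fin n))).filter fun S => S.card = m ∧ ¬ Disjoint S X).card
      ≤ X.card * n ^ (m - 1) := by
  classical
  have : ((Finset.univ : Finset (Finset (Fin n))).filter fun S => S.card = m ∧ ¬ Disjoint S X) ⊆
      X.biUnion fun p => (Finset.powersetCard (m - 1) Finset.univ).image (insert p) := by
    intro S hS
    obtain ⟨-, hc, hd⟩ := Finset.mem_filter.1 hS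
    obtain ⟨p, hp, hpX⟩ := Finset.not_disjoint_iff.1 hd
    rw [Finset.mem_biUnion]
    refine ⟨p, hpX, Finset.mem_image.2 ⟨S.erase p, ?_, Finset.insert_erase hp⟩⟩
    rw [Finset.mem_powersetCard]
    exact ⟨Finset.subset_univ _, by rw [Finset.card_erase_of_mem hp, hc]⟩
  refine (Finset.card_le_card this).trans ?_
  refine Finset.card_biUnion_le_card_mul _ _ _ fun p _ => ?_
  refine Finset.card_image_le.trans ?_
  rw [Finset.card_powersetCard, Finset.card_univ, Fintype.card_fin]
  exact Nat.choose_le_pow n (m - 1)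

lemma count_avoid {n : ℕ} (H : Finset (Finset (Fin n))) (c : ℕ) (hc : 1 ≤ c) (η : ℝ) (x y : Fin n)
    (hcl : Close H c η x y) (X : Finset (Fin n)) (hX : 2 * (X.card : ℝ) ≤ η * n) :
    η / 2 * (n : ℝ) ^ (4 * c - 1) ≤
      (({S : Finset (Fin n) | IsConnector H c x y S ∧ Disjoint S X}.ncard : ℕ) : ℝ) := by
  classical
  unfold Close at hcl
  set F : Finset (Finset (Fin n)) := Finset.univ.filter fun S => IsConnector H c x y S with hF
  set G : Finset (Finset (Fin n)) :=
    Finset.univ.filter fun S => IsConnector H c x y S ∧ Disjoint S X with hG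
  have e : {S : Finset (Fin n) | IsConnector H c x y S} = (F : Set (Finset (Fin n))) := by
    ext S; simp [hF]
  have e' : {S : Finset (Fin n) | IsConnector H c x y S ∧ Disjoint S X} =
      (G : Set (Finset (Fin n))) := by
    ext S; simp [hG]
  rw [e, Set.ncard_coe_finset] at hcl
  rw [e', Set.ncard_coe_finset]
  have h1 := count_hit (4 * c - 1) (by omega) X
  set B := (Finset.univ : Finset (Finset (Fin n))).filter
    fun S => S.card = 4 * c - 1 ∧ ¬ Disjoint S X with hB
  have h2 : F ⊆ G ∪ B := by
    intro S hS
    have hS' := (Finset.mem_filter.1 hS).2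
    by_cases hd : Disjoint S X
    · exact Finset.mem_union_left _ (Finset.mem_filter.2 ⟨Finset.mem_univ _, hS', hd⟩)
    · exact Finset.mem_union_right _ (Finset.mem_filter.2 ⟨Finset.mem_univ _, hS'.2.2.1, hd⟩)
  have h3 : (F.card : ℝ) ≤ G.card + B.card := by
    exact_mod_cast (Finset.card_le_card h2).trans (Finset.card_union_le _ _)
  have h4 : (B.card : ℝ) ≤ X.card * (n : ℝ) ^ (4 * c - 1 - 1) := by exact_mod_cast h1
  have h5 : (n : ℝ) ^ (4 * c - 1) = n ^ (4 * c - 1 - 1) * n := by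
    rw [← pow_succ]; congr 1; omega
  have h6 := mul_le_mul_of_nonneg_right hX (by positivity : 0 ≤ (n : ℝ) ^ (4 * c - 1 - 1))
  rw [h5] at hcl ⊢
  nlinarith

lemma close_concat (c₁ c₂ : ℕ) (h₁ : 1 ≤ c₁) (h₂ : 1 ≤ c₂) (α η₁ η₂ : ℝ) (hα : 0 < α)
    (hη₁ : 0 < η₁) (hη₂ : 0 < η₂) :
    ∃ η : ℝ, 0 < η ∧ ∃ n₀ : ℕ, ∀ n : ℕ, n₀ ≤ n → ∀ H : Finset (Finset (Fin n)),
      ∀ x y : Fin n, ∀ Z : Finset (Fin n), α * n ≤ Z.card →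
        (∀ z ∈ Z, Close H c₁ η₁ x z) → (∀ z ∈ Z, Close H c₂ η₂ z y) →
        Close H (c₁ + c₂) η x y := by
  classical
  set m := 4 * (c₁ + c₂) - 1 with hm
  set M : ℕ := m * (2 ^ m * 2 ^ m) with hM
  have hMpos : 0 < M := by
    have : 0 < m := by omega
    positivity
  have hMpos' : (0 : ℝ) < M := by exact_mod_cast hMpos
  obtain ⟨n₁, hn₁⟩ := exists_nat_ge (4 / α)
  obtain ⟨n₂, hn₂⟩ := exists_nat_ge (2 / η₁)
  obtain ⟨n₃, hn₃⟩ := exists_nat_ge (2 * (4 * c₁) / η₂)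
  refine ⟨α / 2 * (η₁ / 2) * (η₂ / 2) / M, by positivity, max n₁ (max n₂ n₃), ?_⟩
  intro n hn H x y Z hZ hxz hzy
  have b1 : 4 ≤ α * n := by
    have : (n₁ : ℝ) ≤ n := by exact_mod_cast (le_max_left _ _).trans hn
    have := hn₁.trans this
    rw [div_le_iff₀ hα] at this; linarith
  have b2 : 2 ≤ η₁ * n := by
    have : (n₂ : ℝ) ≤ n := by
      exact_mod_cast ((le_max_left _ _).trans (le_max_right _ _)).trans hn
    have := hn₂.trans this
    rw [div_le_iff₀ hη₁] at this; linarith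
  have b3 : 2 * (4 * c₁) ≤ η₂ * n := by
    have : (n₃ : ℝ) ≤ n := by
      exact_mod_cast ((le_max_right _ _).trans (le_max_right _ _)).trans hn
    have := hn₃.trans this
    rw [div_le_iff₀ hη₂] at this; linarith
  set Z' := Z \ {x, y} with hZ'
  have hZ'c : α / 2 * n ≤ (Z'.card : ℝ) := by
    have h := Finset.le_card_sdiff ({x, y} : Finset (Fin n)) Z
    have h' := Finset.card_le_two (a := x) (b := y)
    rw [← hZ'] at h
    have : (Z.card : ℝ) ≤ Z'.card + 2 := by
      have : Z.card ≤ Z'.card + 2 := by omega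
      exact_mod_cast this
    linarith
  set C₁ : Fin n → Finset (Finset (Fin n)) := fun z =>
    Finset.univ.filter fun S => IsConnector H c₁ x z S ∧ Disjoint S {y} with hC₁
  set C₂ : Fin n → Finset (Fin n) → Finset (Finset (Fin n)) := fun z S₁ =>
    Finset.univ.filter fun S => IsConnector H c₂ z y S ∧ Disjoint S (insert x S₁) with hC₂
  have k1 : ∀ z ∈ Z', η₁ / 2 * (n : ℝ) ^ (4 * c₁ - 1) ≤ ((C₁ z).card : ℝ) := by
    intro z hz
    have := count_avoid H c₁ h₁ η₁ x z (hxz z (Finset.mem_sdiff.1 hz).1) {y} (by simpa using b2)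
    have e : {S : Finset (Fin n) | IsConnector H c₁ x z S ∧ Disjoint S {y}} =
      (C₁ z : Set (Finset (Fin n))) := by ext S; simp [hC₁]
    rwa [e, Set.ncard_coe_finset] at this
  have k2 : ∀ z ∈ Z', ∀ S₁ ∈ C₁ z,
      η₂ / 2 * (n : ℝ) ^ (4 * c₂ - 1) ≤ ((C₂ z S₁).card : ℝ) := by
    intro z hz S₁ hS₁
    have hS := (Finset.mem_filter.1 hS₁).2.1
    have hcard : (insert x S₁).card = 4 * c₁ := by
      rw [Finset.card_insert_of_notMem hS.1, hS.2.2.1]; omega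
    have := count_avoid H c₂ h₂ η₂ z y (hzy z (Finset.mem_sdiff.1 hz).1) (insert x S₁)
      (by rw [hcard]; push_cast; exact b3)
    have e : {S : Finset (Fin n) | IsConnector H c₂ z y S ∧ Disjoint S (insert x S₁)} =
      (C₂ z S₁ : Set (Finset (Fin n))) := by ext S; simp [hC₂]
    rwa [e, Set.ncard_coe_finset] at this
  set A : Finset ((_ : Fin n) × (_ : Finset (Fin n)) × Finset (Fin n)) :=
    Z'.sigma fun z => (C₁ z).sigma fun S₁ => C₂ z S₁ with hA
  have hAcard : α / 2 * (η₁ / 2) * (η₂ / 2) * (n : ℝ) ^ m ≤ (A.card : ℝ) := by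
    rw [hA, Finset.card_sigma]
    push_cast
    have t1 : ∀ z ∈ Z', (η₁ / 2 * (n : ℝ) ^ (4 * c₁ - 1)) * (η₂ / 2 * (n : ℝ) ^ (4 * c₂ - 1)) ≤
        ((((C₁ z).sigma fun S₁ => C₂ z S₁).card : ℕ) : ℝ) := by
      intro z hz
      rw [Finset.card_sigma]
      push_cast
      have := Finset.card_nsmul_le_sum (C₁ z) (fun S₁ => ((C₂ z S₁).card : ℝ)) _ (k2 z hz)
      refine le_trans ?_ this
      rw [nsmul_eq_mul]
      exact mul_le_mul_of_nonneg_right (k1 z hz) (by positivity)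
    have := Finset.card_nsmul_le_sum Z' _ _ t1
    refine le_trans ?_ this
    rw [nsmul_eq_mul]
    have hp : (n : ℝ) ^ m = n * n ^ (4 * c₁ - 1) * n ^ (4 * c₂ - 1) := by
      rw [← pow_succ', ← pow_add]; congr 1; omega
    refine le_trans (le_of_eq ?_) (mul_le_mul_of_nonneg_right hZ'c (by positivity))
    rw [hp]; ring
  set F : Finset (Finset (Fin n)) :=
    Finset.univ.filter fun S => IsConnector H (c₁ + c₂) x y S with hF
  have hmaps : A.card ≤ M * F.card := by
    refine Finset.card_le_mul_card_image_of_maps_to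
      (f := fun t : (_ : Fin n) × (_ : Finset (Fin n)) × Finset (Fin n) =>
        insert t.1 (t.2.1 ∪ t.2.2)) ?_ M ?_
    · rintro ⟨z, S₁, S₂⟩ ht
      simp only [hA, Finset.mem_sigma] at ht
      obtain ⟨hz, hS₁, hS₂⟩ := ht
      obtain ⟨-, ⟨x1, z1, card1, fx1, fz1⟩, d1⟩ := Finset.mem_filter.1 hS₁
      obtain ⟨-, ⟨z2, y2, card2, fz2, fy2⟩, d2⟩ := Finset.mem_filter.1 hS₂
      rw [Finset.disjoint_singleton_right] at d1
      rw [Finset.disjoint_insert_right] at d2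
      obtain ⟨x2, d2⟩ := d2
      have hzx : z ≠ x := by
        rintro rfl; simp [hZ'] at hz
      have hzy' : z ≠ y := by
        rintro rfl; simp [hZ'] at hz
      rw [hF]
      refine Finset.mem_filter.2 ⟨Finset.mem_univ _, ?_, ?_, ?_, ?_, ?_⟩
      · simp [hzx.symm, x1, x2]
      · simp [hzy'.symm, d1, y2]
      · rw [Finset.card_insert_of_notMem (by simp [z1, z2]), Finset.card_union_of_disjoint d2.symm,
          card1, card2]
        omega
      · have : insert x (insert z (S₁ ∪ S₂)) = insert x S₁ ∪ insert z S₂ := by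
          ext w; simp only [Finset.mem_insert, Finset.mem_union]; tauto
        simp only []
        rw [this]
        refine factor_union fx1 fz2 ?_
        rw [Finset.disjoint_insert_left, Finset.disjoint_insert_right]
        exact ⟨by simp [hzx.symm, x2], z1, d2.symm⟩
      · have : insert y (insert z (S₁ ∪ S₂)) = insert z S₁ ∪ insert y S₂ := by
          ext w; simp only [Finset.mem_insert, Finset.mem_union]; tauto
        simp only []
        rw [this]
        refine factor_union fz1 fy2 ?_
        rw [Finset.disjoint_insert_left, Finset.disjoint_insert_right]
        exact ⟨by simp [hzy', z2], d1, d2.symm⟩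
    · intro S hS
      have hScard : S.card = m := (Finset.mem_filter.1 hS).2.2.2.1
      have hsub : (A.filter fun t => insert t.1 (t.2.1 ∪ t.2.2) = S) ⊆
          S.sigma fun _ => S.powerset.sigma fun _ => S.powerset := by
        rintro ⟨z, S₁, S₂⟩ ht
        have hSS := (Finset.mem_filter.1 ht).2
        simp only at hSS
        simp only [Finset.mem_sigma, Finset.mem_powerset]
        rw [← hSS]
        refine ⟨Finset.mem_insert_self _ _, ?_, ?_⟩
        · exact Finset.subset_union_left.trans (Finset.subset_insert _ _)
        · exact Finset.subset_union_right.trans (Finset.subset_insert _ _)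
      refine (Finset.card_le_card hsub).trans ?_
      simp [Finset.card_sigma, hScard, hM]
  unfold Close
  have e : {S : Finset (Fin n) | IsConnector H (c₁ + c₂) x y S} = (F : Set (Finset (Fin n))) := by
    ext S; simp [hF]
  rw [e, Set.ncard_coe_finset, ← hm, div_mul_eq_mul_div, div_le_iff₀ hMpos']
  refine hAcard.trans ?_
  have : (A.card : ℝ) ≤ M * F.card := by exact_mod_cast hmaps
  linarith

end Concrete
/-- if some vertex lies in `L(e)` for few edges `e`, then after
removing a small set `V₀` spanning a `K₄⁻`-factor, the rest is `(6,η*)`-closed. -/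
theorem stmt_12 :
    ∃ ηs : ℝ, 0 < ηs ∧
      ∃ γ₀ : ℝ, 0 < γ₀ ∧ ∀ γ : ℝ, 0 < γ → γ ≤ γ₀ →
        ∃ ε₀ : ℝ, 0 < ε₀ ∧ ∀ ε : ℝ, 0 < ε → ε ≤ ε₀ →
          ∃ n₀ : ℕ, ∀ n : ℕ, n₀ ≤ n →
            ∀ H : Finset (Finset (Fin n)), Is3Graph n H →
              CodegLB H ((1 / 2 - γ) * n) →
              ∀ v : Fin n,
                ({e : Finset (Fin n) | e ∈ H ∧
                    SpansK4m H (insert v e)}.ncard : ℝ) < ε * (n : ℝ) ^ 3 →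
                ∃ V₀ : Finset (Fin n),
                  (V₀.card : ℝ) ≤ 8 * ε ^ ((1 : ℝ) / 4) * n ∧
                  HasK4mFactorOn H V₀ ∧
                  ClosedInSub H (Finset.univ \ V₀) 6 ηs := by
  classical
  obtain ⟨η₂, hη₂, n₂, H₂⟩ := close_concat 1 1 le_rfl le_rfl (1 / 10 ^ 4) (1 / 10 ^ 4 / 27)
    (1 / 10 ^ 4 / 27) (by norm_num) (by norm_num) (by norm_num)
  obtain ⟨η₄, hη₄, n₄, H₄⟩ := close_concat 2 2 (by norm_num) (by norm_num) (1 / 10 ^ 4) η₂ η₂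
    (by norm_num) hη₂ hη₂
  obtain ⟨η₆, hη₆, n₆, H₆⟩ := close_concat 4 2 (by norm_num) (by norm_num) (1 / 10 ^ 4) η₄ η₂
    (by norm_num) hη₄ hη₂
  refine ⟨η₆, hη₆, 1 / 10 ^ 10, by norm_num, fun γ _ hγ => ⟨1 / 10 ^ 10 / 27, by norm_num,
    fun ε hε0 hε => ⟨max (10 ^ 10) (max n₂ (max n₄ n₆)), ?_⟩⟩⟩
  intro n hn H h3 hdeg v hv
  have hn1 : 10 ^ 10 ≤ n := (le_max_left _ _).trans hn
  have hn' := (le_max_right _ _).trans hn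
  have hn2 : n₂ ≤ n := (le_max_left _ _).trans hn'
  have hn'' := (le_max_right _ _).trans hn'
  have hn4 : n₄ ≤ n := (le_max_left _ _).trans hn''
  have hn6 : n₆ ≤ n := (le_max_right _ _).trans hn''
  have hnR : (10 : ℝ) ^ 10 ≤ n := by exact_mod_cast hn1
  have hn3 : (0 : ℝ) ≤ (n : ℝ) ^ 3 := by positivity
  have hcard : (Fintype.card (Fin n) : ℝ) = n := by rw [Fintype.card_fin]
  have hh : ∀ a b c, hInd H a b c = 0 ∨ hInd H a b c = 1 := by
    intro a b c; unfold hInd; split_ifs <;> simp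
  have hk : ∀ x a b c, kInd H x a b c = 0 ∨ kInd H x a b c = 1 := by
    intro x a b c; unfold kInd; split_ifs <;> simp
  have hs1 : ∀ a b c, hInd H a b c = hInd H b a c := by
    intro a b c; unfold hInd; rw [Finset.insert_comm]
  have hs2 : ∀ a b c, hInd H a b c = hInd H a c b := by
    intro a b c; unfold hInd; rw [Finset.pair_comm]
  have hdiag : ∀ a c, hInd H a a c = 0 := by
    intro a c; unfold hInd
    rw [if_neg]
    intro hm
    exact (ne_of_card_three (h3 _ hm)).1 rfl
  have hsum : ∀ a b, ∑ c, hInd H a b c = (degOn H a b Finset.univ : ℝ) := by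
    intro a b; unfold hInd degOn
    rw [Finset.card_filter]; push_cast; rfl
  have hdeg' : ∀ a b, a ≠ b → (1 / 2 - 1 / 10 ^ 10) * (n : ℝ) ≤ ∑ c, hInd H a b c := by
    intro a b hab
    rw [hsum]
    refine le_trans ?_ (hdeg a b hab)
    exact mul_le_mul_of_nonneg_right (by linarith) (by positivity)
  have hvv : ∑ a, ∑ b, ∑ c, hInd H a b c * hInd H v a b * hInd H v a c ≤
      1 / 10 ^ 10 * (n : ℝ) ^ 3 := by
    set F : Finset (Finset (Fin n)) :=
      Finset.univ.filter fun e => e ∈ H ∧ SpansK4m H (insert v e) with hF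
    have e : {e : Finset (Fin n) | e ∈ H ∧ SpansK4m H (insert v e)} =
        (F : Set (Finset (Fin n))) := by ext S; simp [hF]
    rw [e, Set.ncard_coe_finset] at hv
    have := ordered_le (fun a b c => hInd H a b c * hInd H v a b * hInd H v a c) F
      (fun S hS => h3 S (Finset.mem_filter.1 hS).2.1)
      (fun a b c => by
        rcases hh a b c with h | h <;> rcases hh v a b with h' | h' <;>
          rcases hh v a c with h'' | h'' <;> norm_num [h, h', h''])
      (fun a b c hp => by
        have hb := (kInd_bounds H h3 v a b c).1
        rw [hF, Finset.mem_filter]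
        refine ⟨Finset.mem_univ _, ?_, ?_⟩
        · by_contra hne
          have : hInd H a b c = 0 := by unfold hInd; rw [if_neg hne]
          simp [this] at hp
        · by_contra hne
          have : kInd H v a b c = 0 := by unfold kInd; rw [if_neg hne]
          rw [this] at hb
          nlinarith)
    have hε' : ε * (n : ℝ) ^ 3 ≤ 1 / 10 ^ 10 / 27 * (n : ℝ) ^ 3 :=
      mul_le_mul_of_nonneg_right hε hn3
    linarith
  obtain ⟨χ, hχ, hlo, hhi, hD⟩ := structure_of_link (hInd H) (1 / 10 ^ 10) (by norm_num) le_rfl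
    (by rw [hcard]; linarith) hh hs1 hs2 hdiag (by rw [hcard]; exact hdeg') v
    (by rw [hcard]; exact hvv)
  rw [hcard] at hlo hhi hD
  obtain ⟨T, hT, hTx⟩ := abstract_close χ (hInd H) (kInd H) (n : ℝ) hcard.symm hnR hχ hh hk hdiag
    (fun a b hab => by have := hdeg' a b hab; linarith) (by linarith) (by linarith)
    (fun x a b c => (kInd_bounds H h3 x a b c).1)
    (fun x a b c => (kInd_bounds H h3 x a b c).2.1)
    (fun x a b c => (kInd_bounds H h3 x a b c).2.2.1)
    (fun x a b c => (kInd_bounds H h3 x a b c).2.2.2) (by linarith)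
  have hTcard : 1 / 10 ^ 4 * (n : ℝ) ≤ (T.card : ℝ) := by
    refine (hTx v).trans ?_
    exact_mod_cast Finset.card_filter_le _ _
  have g2 : ∀ x, ∀ t ∈ T, Close H 2 η₂ x t := by
    intro x t ht
    refine H₂ n hn2 H x t _ (hTx x) ?_ ?_
    · intro z hz
      exact close_one (Finset.mem_filter.1 hz).2
    · intro z hz
      exact close_one (hT z (Finset.mem_filter.1 hz).1 t ht)
  have g4 : ∀ x, ∀ t ∈ T, Close H 4 η₄ x t := by
    intro x t ht
    exact H₄ n hn4 H x t T hTcard (g2 x) fun z _ => g2 z t ht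
  have g6 : ∀ x y, Close H 6 η₆ x y := by
    intro x y
    exact H₆ n hn6 H x y T hTcard (g4 x) fun z hz => close_symm (g2 y z hz)
  refine ⟨∅, ?_, ⟨∅, by simp, by simp, by simp⟩, ?_⟩
  · rw [Finset.card_empty, Nat.cast_zero]; positivity
  · intro x _ y _ _
    have := g6 x y
    unfold Close at this
    unfold CloseIn
    simpa using this
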